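/- Let u ∈ ℝⁿ be a unit Fiedler vector of layer 1, i.e. ‖u‖ = 1, uᵀ1ₙ = 0 and L₁u = λ₂⁽¹⁾·u where λ₂⁽¹⁾ = λ₂(L₁). Then for every n×m matrix W with nonnegative entries, λ₂(L(W)) ≤ λ₂⁽¹⁾ + uᵀ·diag(W1ₘ)·u. -/

import Mathlib

open Matrix

noncomputable def supraLap {n m : ℕ} (L₁ : Matrix (Fin n) (Fin n) ℝ)
    (L₂ : Matrix (Fin m) (Fin m) ℝ) (W : Matrix (Fin n) (Fin m) ℝ) :
    Matrix (Fin n ⊕ Fin m) (Fin n ⊕ Fin m) ℝ :=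
  Matrix.fromBlocks (L₁ + Matrix.diagonal (W *ᵥ fun _ => 1)) (-W)
    (-Wᵀ) (L₂ + Matrix.diagonal (Wᵀ *ᵥ fun _ => 1))

noncomputable def lam2 {K : Type*} [Fintype K] (M : Matrix K K ℝ) : ℝ :=
  sInf {r : ℝ | ∃ v : K → ℝ, v ≠ 0 ∧ (∑ i, v i) = 0 ∧
    r = (v ⬝ᵥ (M *ᵥ v)) / (∑ i, (v i) ^ 2)}

theorem stmt_5 {n m : ℕ} (hn : 2 ≤ n) (hm : 2 ≤ m)
    (L₁ : Matrix (Fin n) (Fin n) ℝ) (L₂ : Matrix (Fin m) (Fin m) ℝ)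
    (hL₁ : L₁.PosSemidef) (hL₂ : L₂.PosSemidef)
    (hL₁1 : L₁ *ᵥ (fun _ => 1) = 0) (hL₂1 : L₂ *ᵥ (fun _ => 1) = 0)
    (u : Fin n → ℝ) (hunorm : (∑ i, (u i) ^ 2) = 1) (husum : (∑ i, u i) = 0)
    (hueig : L₁ *ᵥ u = lam2 L₁ • u)
    (W : Matrix (Fin n) (Fin m) ℝ) (hW : ∀ i j, 0 ≤ W i j) :
    lam2 (supraLap L₁ L₂ W) ≤
      lam2 L₁ + u ⬝ᵥ (Matrix.diagonal (W *ᵥ fun _ => 1) *ᵥ u) := by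
  have hquad : ∀ v : Fin n ⊕ Fin m → ℝ, 0 ≤ v ⬝ᵥ (supraLap L₁ L₂ W *ᵥ v) := by
    intro v
    obtain ⟨a, b, rfl⟩ : ∃ (a : Fin n → ℝ) (b : Fin m → ℝ), v = Sum.elim a b :=
      ⟨v ∘ Sum.inl, v ∘ Sum.inr, (Sum.elim_comp_inl_inr v).symm⟩
    have h1 : 0 ≤ a ⬝ᵥ (L₁ *ᵥ a) := by simpa using hL₁.dotProduct_mulVec_nonneg a
    have h2 : 0 ≤ b ⬝ᵥ (L₂ *ᵥ b) := by simpa using hL₂.dotProduct_mulVec_nonneg b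
    have h3 : 0 ≤ ∑ i, ∑ j, W i j * (a i - b j) ^ 2 :=
      Finset.sum_nonneg fun i _ => Finset.sum_nonneg fun j _ =>
        mul_nonneg (hW i j) (sq_nonneg _)
    have e1 : a ⬝ᵥ (Matrix.diagonal (W *ᵥ fun _ => 1) *ᵥ a)
        = ∑ i, ∑ j, W i j * a i ^ 2 := by
      simp only [dotProduct, mulVec_diagonal]
      refine Finset.sum_congr rfl fun i _ => ?_
      simp only [mulVec, dotProduct, mul_one, Finset.sum_mul, Finset.mul_sum]
      exact Finset.sum_congr rfl fun j _ => by ring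
    have e2 : b ⬝ᵥ (Matrix.diagonal (Wᵀ *ᵥ fun _ => 1) *ᵥ b)
        = ∑ i, ∑ j, W i j * b j ^ 2 := by
      rw [Finset.sum_comm]
      simp only [dotProduct, mulVec_diagonal]
      refine Finset.sum_congr rfl fun i _ => ?_
      simp only [mulVec, dotProduct, mul_one, Finset.sum_mul, Finset.mul_sum, transpose_apply]
      exact Finset.sum_congr rfl fun j _ => by ring
    have e3 : a ⬝ᵥ (W *ᵥ b) = ∑ i, ∑ j, W i j * (a i * b j) := by
      simp only [mulVec, dotProduct, Finset.mul_sum]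
      exact Finset.sum_congr rfl fun i _ => Finset.sum_congr rfl fun j _ => by ring
    have e4 : b ⬝ᵥ (Wᵀ *ᵥ a) = ∑ i, ∑ j, W i j * (a i * b j) := by
      rw [Finset.sum_comm]
      simp only [mulVec, dotProduct, Finset.mul_sum, transpose_apply]
      exact Finset.sum_congr rfl fun i _ => Finset.sum_congr rfl fun j _ => by ring
    have e5 : ∑ i, ∑ j, W i j * (a i - b j) ^ 2
        = ∑ i, ∑ j, W i j * a i ^ 2 + ∑ i, ∑ j, W i j * b j ^ 2
          - 2 * ∑ i, ∑ j, W i j * (a i * b j) := by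
      simp only [Finset.mul_sum, ← Finset.sum_add_distrib, ← Finset.sum_sub_distrib]
      exact Finset.sum_congr rfl fun i _ => Finset.sum_congr rfl fun j _ => by ring
    rw [supraLap, fromBlocks_mulVec, sumElim_dotProduct_sumElim]
    simp only [Sum.elim_comp_inl, Sum.elim_comp_inr, add_mulVec, neg_mulVec,
      dotProduct_add, dotProduct_neg, e1, e2, e3, e4]
    linarith
  have huu : u ⬝ᵥ u = 1 := by
    rw [← hunorm]; exact Finset.sum_congr rfl fun i _ => (sq (u i)).symm
  unfold lam2 at hueig ⊢
  apply csInf_le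
  · refine ⟨0, ?_⟩
    rintro r ⟨v, -, -, rfl⟩
    exact div_nonneg (hquad v) (Finset.sum_nonneg fun i _ => sq_nonneg _)
  · refine ⟨Sum.elim u 0, ?_, ?_, ?_⟩
    · intro h
      have : u = 0 := by
        funext i
        simpa using congrFun h (Sum.inl i)
      simp [this] at hunorm
    · simp [husum]
    · rw [supraLap, fromBlocks_mulVec, sumElim_dotProduct_sumElim]
      simp only [Sum.elim_comp_inl, Sum.elim_comp_inr, add_mulVec, hueig, dotProduct_add,
        dotProduct_smul, huu, Fintype.sum_sum_type, Sum.elim_inl, Sum.elim_inr, hunorm]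
      simp
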